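/- arXiv:1607.08556 — 5 statements merged into one kernel-verified Lean document; each statement's English description precedes it below -/
import Mathlib

section
/- Let α, β, γ, λ, ν ∈ ℝ with α ≥ 0 and αγ − β² ≥ 0, and let M ⊆ ℝ be a nonempty open interval on which q(x) = αx² + 2βx + γ > 0. Then there exists a smooth function Y¹: M → ℝ, not identically zero, satisfying the two determining equations ((αx+β)/√q(x))·Y¹(x) − (Y¹)'(x)·√q(x) = 0 and λ·Y¹(x) − (q(x)/2)·(Y¹)''(x) − (Y¹)'(x)·(λx+ν) = 0 for all x ∈ M, if and only if 2βν − 2γλ + αγ − β² = 0 and αν − βλ = 0. -/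
noncomputable section

theorem hasDerivAt_quadratic (α β γ x : ℝ) :
    HasDerivAt (fun y : ℝ => α * y ^ 2 + 2 * β * y + γ) (2 * (α * x + β)) x := by
  refine ((((hasDerivAt_pow 2 x).const_mul α).fun_add
    ((hasDerivAt_id' x).const_mul (2 * β))).add_const γ).congr_deriv ?_
  norm_num
  ring

/-- If `f` solves `q f' = (α x + β) f` on an open set where `q = α x² + 2 β x + γ` is positive,
then `q² f'' = (α γ - β²) f` there. -/
theorem deriv_deriv_of_deriv_eq_logDeriv_sqrt_quadratic {α β γ : ℝ} {M : Set ℝ} (hM : IsOpen M)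
    (hq : ∀ x ∈ M, 0 < α * x ^ 2 + 2 * β * x + γ) {f : ℝ → ℝ} (hf : DifferentiableOn ℝ f M)
    (h : ∀ x ∈ M, deriv f x = (α * x + β) / (α * x ^ 2 + 2 * β * x + γ) * f x)
    {x : ℝ} (hx : x ∈ M) :
    deriv (deriv f) x = (α * γ - β ^ 2) / (α * x ^ 2 + 2 * β * x + γ) ^ 2 * f x := by
  have hq0 := (hq x hx).ne'
  have heq : deriv f =ᶠ[nhds x]
      fun y => (α * y + β) / (α * y ^ 2 + 2 * β * y + γ) * f y :=
    Filter.eventually_of_mem (hM.mem_nhds hx) h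
  have hfx : HasDerivAt f (deriv f x) x := (hf.differentiableAt (hM.mem_nhds hx)).hasDerivAt
  have hlin : HasDerivAt (fun y : ℝ => α * y + β) α x := by
    simpa using ((hasDerivAt_id x).const_mul α).add_const β
  rw [heq.deriv_eq, ((hlin.fun_div (hasDerivAt_quadratic α β γ x) hq0).fun_mul hfx).deriv, h x hx]
  field_simp
  ring

/-- An affine function vanishing on a nonempty open set has zero coefficients. -/
theorem affine_coeff_eq_zero_of_isOpen {a b : ℝ} {U : Set ℝ} (hU : IsOpen U) (hne : U.Nonempty)
    (h : ∀ x ∈ U, a * x + b = 0) : a = 0 ∧ b = 0 := by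
  obtain ⟨x, hx⟩ := hne
  obtain ⟨ε, hε, hball⟩ := Metric.isOpen_iff.1 hU x hx
  have h₁ := h x hx
  have h₂ := h (x + ε / 2) (hball (by
    rw [Metric.mem_ball, Real.dist_eq, add_sub_cancel_left, abs_of_pos (half_pos hε)]
    exact half_lt_self hε))
  have ha : a = 0 := by
    have : a * (ε / 2) = 0 := by linarith
    exact (mul_eq_zero.1 this).resolve_right (half_pos hε).ne'
  exact ⟨ha, by simpa [ha] using h₁⟩

/-- For `q f' = (α x + β) f`, the second determining equation is `f` times an affine function. -/
theorem second_determining_eq_iff {α β γ lam ν : ℝ} {M : Set ℝ} (hM : IsOpen M)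
    (hq : ∀ x ∈ M, 0 < α * x ^ 2 + 2 * β * x + γ) {f : ℝ → ℝ} (hf : DifferentiableOn ℝ f M)
    (h : ∀ x ∈ M, deriv f x = (α * x + β) / (α * x ^ 2 + 2 * β * x + γ) * f x)
    {x : ℝ} (hx : x ∈ M) :
    lam * f x - ((α * x ^ 2 + 2 * β * x + γ) / 2) * deriv (deriv f) x
        - deriv f x * (lam * x + ν) = 0 ↔
      f x * (2 * (α * ν - β * lam) * x
        + (2 * β * ν - 2 * γ * lam + α * γ - β ^ 2)) = 0 := by
  have hq0 := (hq x hx).ne'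
  rw [deriv_deriv_of_deriv_eq_logDeriv_sqrt_quadratic hM hq hf h hx, h x hx]
  have key : lam * f x - ((α * x ^ 2 + 2 * β * x + γ) / 2) *
        ((α * γ - β ^ 2) / (α * x ^ 2 + 2 * β * x + γ) ^ 2 * f x)
        - (α * x + β) / (α * x ^ 2 + 2 * β * x + γ) * f x * (lam * x + ν) =
      f x * (2 * (α * ν - β * lam) * x + (2 * β * ν - 2 * γ * lam + α * γ - β ^ 2)) *
        (-1 / (2 * (α * x ^ 2 + 2 * β * x + γ))) := by
    generalize hquad : α * x ^ 2 + 2 * β * x + γ = p at hq0 ⊢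
    field_simp
    rw [← hquad]
    ring
  rw [key, mul_eq_zero, or_iff_left]
  exact div_ne_zero (by norm_num) (mul_ne_zero two_ne_zero hq0)

/-- The first determining equation in terms of the logarithmic derivative of `√q`. -/
theorem first_determining_eq_iff {a q y d : ℝ} (hq : 0 < q) :
    a / Real.sqrt q * y - d * Real.sqrt q = 0 ↔ d = a / q * y := by
  have hs := (Real.sqrt_pos.2 hq).ne'
  have h : a / q * y = a / Real.sqrt q * y / Real.sqrt q := by
    conv_lhs => rw [← Real.mul_self_sqrt hq.le]
    field_simp
  rw [h, eq_div_iff hs, sub_eq_zero, eq_comm]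

/-- Proposition 5.1.  The one-dimensional Kolmogorov–Pearson SDE
`dX = (λX+ν)dt + √(αX²+2βX+γ) dW` admits a (nonzero) strong symmetry `Y = Y¹∂_x`, i.e. a
smooth nontrivial solution of the two determining equations, if and only if
`2βν − 2γλ + αγ − β² = 0` and `αν − βλ = 0`. -/
theorem kolmogorov_pearson_strong_symmetry_iff
    (α β γ lam ν : ℝ) (hα : 0 ≤ α) (hdisc : 0 ≤ α * γ - β ^ 2)
    (M : Set ℝ) (hMopen : IsOpen M) (hMconn : IsPreconnected M) (hMne : M.Nonempty)
    (hq : ∀ x ∈ M, 0 < α * x ^ 2 + 2 * β * x + γ) :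
    (∃ Y : ℝ → ℝ, ContDiffOn ℝ (⊤ : ℕ∞) Y M ∧ ¬ (∀ x ∈ M, Y x = 0) ∧
      (∀ x ∈ M,
        ((α * x + β) / Real.sqrt (α * x ^ 2 + 2 * β * x + γ)) * Y x
          - deriv Y x * Real.sqrt (α * x ^ 2 + 2 * β * x + γ) = 0) ∧
      (∀ x ∈ M,
        lam * Y x - ((α * x ^ 2 + 2 * β * x + γ) / 2) * deriv (deriv Y) x
          - deriv Y x * (lam * x + ν) = 0))
    ↔ (2 * β * ν - 2 * γ * lam + α * γ - β ^ 2 = 0 ∧ α * ν - β * lam = 0) := by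
  constructor
  · rintro ⟨Y, hY, hY0, h₁, h₂⟩
    push Not at hY0
    obtain ⟨x₀, hx₀, hYx₀⟩ := hY0
    have hd : ∀ x ∈ M, deriv Y x = (α * x + β) / (α * x ^ 2 + 2 * β * x + γ) * Y x :=
      fun x hx => (first_determining_eq_iff (hq x hx)).1 (h₁ x hx)
    obtain ⟨ha, hb⟩ := affine_coeff_eq_zero_of_isOpen
      (hY.continuousOn.isOpen_inter_preimage hMopen isOpen_compl_singleton)
      ⟨x₀, hx₀, hYx₀⟩ fun x hx => (mul_eq_zero.1 ((second_determining_eq_iff hMopen hq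
        (hY.differentiableOn (by simp)) hd hx.1).1 (h₂ x hx.1))).resolve_left hx.2
    exact ⟨hb, by linarith⟩
  · rintro ⟨hb, ha⟩
    have hY : ContDiffOn ℝ (⊤ : ℕ∞)
        (fun x => Real.sqrt (α * x ^ 2 + 2 * β * x + γ)) M :=
      ContDiffOn.sqrt (by fun_prop) fun x hx => (hq x hx).ne'
    have hd : ∀ x ∈ M, deriv (fun x => Real.sqrt (α * x ^ 2 + 2 * β * x + γ)) x =
        (α * x + β) / (α * x ^ 2 + 2 * β * x + γ) *
          Real.sqrt (α * x ^ 2 + 2 * β * x + γ) := by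
      intro x hx
      rw [((hasDerivAt_quadratic α β γ x).sqrt (hq x hx).ne').deriv, ← first_determining_eq_iff (hq x hx)]
      have hs := (Real.sqrt_pos.2 (hq x hx)).ne'
      field_simp
      ring
    refine ⟨_, hY, ?_, fun x hx => (first_determining_eq_iff (hq x hx)).2 (hd x hx),
      fun x hx => (second_determining_eq_iff hMopen hq
        (hY.differentiableOn (by simp)) hd hx).2 ?_⟩
    · obtain ⟨x, hx⟩ := hMne
      exact fun h => (Real.sqrt_pos.2 (hq x hx)).ne' (h x hx)
    · rw [ha, hb]
      ring
end
end

section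
/- Let α, β, γ, λ, ν ∈ ℝ with αγ − β² ≥ 0, let q(x) = αx² + 2βx + γ, and let M = {(x,z) ∈ ℝ² : q(x) > 0}. Consider the smooth SDE (μ,σ) on M (with m = 2) given by μ(x,z) = (λx + ν, λz)^T and σ(x,z) = [[√q(x), 0], [z(αx+β)/√q(x), z√(αγ−β²)/√q(x)]]. Then V₁ = (Y₁, C₁, 0) with Y₁(x,z) = (z, 0)^T and C₁(x,z) = [[0, z√(αγ−β²)/q(x)], [−z√(αγ−β²)/q(x), 0]], and V₂ = (Y₂, 0, 0) with Y₂(x,z) = (0, z)^T, are infinitesimal symmetries of (μ,σ). -/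
noncomputable section

open scoped BigOperators

/-- Partial derivative `∂_j f` at `x`. -/
def pd {d : ℕ} (f : (Fin d → ℝ) → ℝ) (j : Fin d) (x : Fin d → ℝ) : ℝ :=
  fderiv ℝ f x (Pi.single j 1)

/-- A vector field `Y` applied to a scalar function: `Y(f) = ∑ k Y^k ∂_k f`. -/
def vfApp {d : ℕ} (Y : (Fin d → ℝ) → Fin d → ℝ) (f : (Fin d → ℝ) → ℝ)
    (x : Fin d → ℝ) : ℝ :=
  ∑ k, Y x k * pd f k x

/-- Lie bracket of two vector fields. -/
def vfBracket {d : ℕ} (X Y : (Fin d → ℝ) → Fin d → ℝ) (x : Fin d → ℝ) :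
    Fin d → ℝ :=
  fun i => ∑ k, (X x k * pd (fun y => Y y i) k x - Y x k * pd (fun y => X y i) k x)

/-- The bracket `[H,K]` of a vector field `H` with a matrix-valued map `K`. -/
def mixBracket {d m : ℕ} (H : (Fin d → ℝ) → Fin d → ℝ)
    (K : (Fin d → ℝ) → Fin d → Fin m → ℝ) (x : Fin d → ℝ) : Fin d → Fin m → ℝ :=
  fun i j => ∑ k, (H x k * pd (fun y => K y i j) k x - K x k j * pd (fun y => H y i) k x)

/-- The generator `L` of the SDE `(μ,σ)`. -/
def gen {d m : ℕ} (μ : (Fin d → ℝ) → Fin d → ℝ)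
    (σ : (Fin d → ℝ) → Fin d → Fin m → ℝ)
    (f : (Fin d → ℝ) → ℝ) (x : Fin d → ℝ) : ℝ :=
  (1/2) * ∑ α : Fin m, ∑ i, ∑ j, σ x i α * σ x j α * pd (fun y => pd f j y) i x
    + ∑ i, μ x i * pd f i x

/-- The determining equations: `(Y,C,τ)` is an infinitesimal symmetry of `(μ,σ)` on `M`. -/
def IsSymmetry {d m : ℕ} (M : Set (Fin d → ℝ))
    (μ : (Fin d → ℝ) → Fin d → ℝ) (σ : (Fin d → ℝ) → Fin d → Fin m → ℝ)
    (Y : (Fin d → ℝ) → Fin d → ℝ) (C : (Fin d → ℝ) → Fin m → Fin m → ℝ)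
    (τ : (Fin d → ℝ) → ℝ) : Prop :=
  (∀ x ∈ M, ∀ i α, mixBracket Y σ x i α
      = -(1/2) * τ x * σ x i α - ∑ β, σ x i β * C x β α) ∧
  (∀ x ∈ M, ∀ i,
      vfApp Y (fun y => μ y i) x - gen μ σ (fun y => Y y i) x = - τ x * μ x i)

/-- The partial derivatives of a function of the first coordinate alone. -/
lemma pd_comp_fst {u : ℝ → ℝ} {u' : ℝ} {x : Fin 2 → ℝ} (hu : HasDerivAt u u' (x 0))
    (j : Fin 2) : pd (fun p => u (p 0)) j x = ![u', 0] j := by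
  have h0 : HasFDerivAt (fun p : Fin 2 → ℝ => p 0)
      (ContinuousLinearMap.proj (R := ℝ) (φ := fun _ : Fin 2 => ℝ) 0) x :=
    hasFDerivAt_apply 0 x
  have h : HasFDerivAt (fun p : Fin 2 → ℝ => u (p 0)) _ x := hu.comp_hasFDerivAt x h0
  rw [pd, h.fderiv]
  fin_cases j <;> simp

/-- The partial derivatives of a function that is linear in the second coordinate. -/
lemma pd_snd_mul_comp_fst {u : ℝ → ℝ} {u' : ℝ} {x : Fin 2 → ℝ}
    (hu : HasDerivAt u u' (x 0)) (j : Fin 2) :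
    pd (fun p => p 1 * u (p 0)) j x = ![x 1 * u', u (x 0)] j := by
  have h0 : HasFDerivAt (fun p : Fin 2 → ℝ => p 0)
      (ContinuousLinearMap.proj (R := ℝ) (φ := fun _ : Fin 2 => ℝ) 0) x :=
    hasFDerivAt_apply 0 x
  have h1 : HasFDerivAt (fun p : Fin 2 → ℝ => p 1)
      (ContinuousLinearMap.proj (R := ℝ) (φ := fun _ : Fin 2 => ℝ) 1) x :=
    hasFDerivAt_apply 1 x
  have h : HasFDerivAt (fun p : Fin 2 → ℝ => p 1 * u (p 0)) _ x :=
    h1.mul (hu.comp_hasFDerivAt x h0)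
  rw [pd, h.fderiv]
  fin_cases j <;> simp

lemma pd_const {d : ℕ} (c : ℝ) (j : Fin d) (x : Fin d → ℝ) : pd (fun _ => c) j x = 0 := by
  simp [pd]

lemma pd_snd (j : Fin 2) (x : Fin 2 → ℝ) : pd (fun p => p 1) j x = ![0, 1] j := by
  simpa using pd_snd_mul_comp_fst (hasDerivAt_const (x 0) (1 : ℝ)) j

section KolmogorovPearson

variable {α β γ : ℝ} {x : Fin 2 → ℝ}

lemma hasDerivAt_sqrt_quadratic {t : ℝ} (ht : 0 < α * t ^ 2 + 2 * β * t + γ) :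
    HasDerivAt (fun t => Real.sqrt (α * t ^ 2 + 2 * β * t + γ))
      ((α * t + β) / Real.sqrt (α * t ^ 2 + 2 * β * t + γ)) t := by
  have hq : HasDerivAt (fun t => α * t ^ 2 + 2 * β * t + γ) (2 * (α * t + β)) t := by
    refine ((((hasDerivAt_pow 2 t).const_mul α).add
      ((hasDerivAt_id t).const_mul (2 * β))).add_const γ).congr_deriv ?_
    norm_num
    ring
  convert hq.sqrt ht.ne' using 1
  rw [mul_div_mul_left _ _ two_ne_zero]

lemma pd_sqrt_quadratic (hx : 0 < α * x 0 ^ 2 + 2 * β * x 0 + γ) (j : Fin 2) :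
    pd (fun p => Real.sqrt (α * p 0 ^ 2 + 2 * β * p 0 + γ)) j x =
      ![(α * x 0 + β) / Real.sqrt (α * x 0 ^ 2 + 2 * β * x 0 + γ), 0] j :=
  pd_comp_fst (hasDerivAt_sqrt_quadratic hx) j

lemma pd_snd_mul_linear_div_sqrt_quadratic (a b : ℝ)
    (hx : 0 < α * x 0 ^ 2 + 2 * β * x 0 + γ) (j : Fin 2) :
    pd (fun p => p 1 * (a * p 0 + b) / Real.sqrt (α * p 0 ^ 2 + 2 * β * p 0 + γ)) j x =
      ![x 1 * ((a * (α * x 0 ^ 2 + 2 * β * x 0 + γ) - (a * x 0 + b) * (α * x 0 + β)) /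
          Real.sqrt (α * x 0 ^ 2 + 2 * β * x 0 + γ) ^ 3),
        (a * x 0 + b) / Real.sqrt (α * x 0 ^ 2 + 2 * β * x 0 + γ)] j := by
  have hs : 0 < Real.sqrt (α * x 0 ^ 2 + 2 * β * x 0 + γ) := Real.sqrt_pos.2 hx
  have hl : HasDerivAt (fun t => a * t + b) a (x 0) := by
    simpa using ((hasDerivAt_id (x 0)).const_mul a).add_const b
  have hu := (hl.fun_div (hasDerivAt_sqrt_quadratic hx) hs.ne').congr_deriv
    (g' := (a * (α * x 0 ^ 2 + 2 * β * x 0 + γ) - (a * x 0 + b) * (α * x 0 + β)) /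
      Real.sqrt (α * x 0 ^ 2 + 2 * β * x 0 + γ) ^ 3) (by
        have hsq := Real.sq_sqrt hx.le
        generalize Real.sqrt (α * x 0 ^ 2 + 2 * β * x 0 + γ) = s at *
        rw [← hsq]
        field_simp)
  simp only [mul_div_assoc (_ : ℝ) (a * _ + b)]
  exact pd_snd_mul_comp_fst hu j

lemma pd_snd_mul_div_sqrt_quadratic (c : ℝ)
    (hx : 0 < α * x 0 ^ 2 + 2 * β * x 0 + γ) (j : Fin 2) :
    pd (fun p => p 1 * c / Real.sqrt (α * p 0 ^ 2 + 2 * β * p 0 + γ)) j x =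
      ![-(x 1 * (c * (α * x 0 + β) / Real.sqrt (α * x 0 ^ 2 + 2 * β * x 0 + γ) ^ 3)),
        c / Real.sqrt (α * x 0 ^ 2 + 2 * β * x 0 + γ)] j := by
  simpa [neg_div] using pd_snd_mul_linear_div_sqrt_quadratic 0 c hx j

end KolmogorovPearson

lemma pd_linear_fst (a b : ℝ) (x : Fin 2 → ℝ) (j : Fin 2) :
    pd (fun p => a * p 0 + b) j x = ![a, 0] j := by
  have hl : HasDerivAt (fun t => a * t + b) a (x 0) := by
    simpa using ((hasDerivAt_id (x 0)).const_mul a).add_const b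
  exact pd_comp_fst hl j

lemma pd_mul_snd (a : ℝ) (x : Fin 2 → ℝ) (j : Fin 2) :
    pd (fun p => a * p 1) j x = ![0, a] j := by
  simpa [mul_comm] using pd_snd_mul_comp_fst (hasDerivAt_const (x 0) a) j

/-- Subsection 5.1.  For the two-dimensional system associated with the
Kolmogorov–Pearson diffusion, the triples `V₁ = (Y₁,C₁,0)` and `V₂ = (Y₂,0,0)` are
infinitesimal symmetries. -/
theorem kolmogorov_pearson_system_symmetries
    (α β γ lam ν : ℝ) (hdisc : 0 ≤ α * γ - β ^ 2) :
    IsSymmetry (m := 2) {p : Fin 2 → ℝ | 0 < α * (p 0) ^ 2 + 2 * β * (p 0) + γ}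
      (fun p => ![lam * p 0 + ν, lam * p 1])
      (fun p => ![![Real.sqrt (α * (p 0) ^ 2 + 2 * β * (p 0) + γ), 0],
        ![p 1 * (α * p 0 + β) / Real.sqrt (α * (p 0) ^ 2 + 2 * β * (p 0) + γ),
          p 1 * Real.sqrt (α * γ - β ^ 2) /
            Real.sqrt (α * (p 0) ^ 2 + 2 * β * (p 0) + γ)]])
      (fun p => ![p 1, 0])
      (fun p => ![![0, p 1 * Real.sqrt (α * γ - β ^ 2) /
            (α * (p 0) ^ 2 + 2 * β * (p 0) + γ)],
        ![-(p 1 * Real.sqrt (α * γ - β ^ 2) /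
            (α * (p 0) ^ 2 + 2 * β * (p 0) + γ)), 0]])
      (fun _ => 0)
    ∧
    IsSymmetry (m := 2) {p : Fin 2 → ℝ | 0 < α * (p 0) ^ 2 + 2 * β * (p 0) + γ}
      (fun p => ![lam * p 0 + ν, lam * p 1])
      (fun p => ![![Real.sqrt (α * (p 0) ^ 2 + 2 * β * (p 0) + γ), 0],
        ![p 1 * (α * p 0 + β) / Real.sqrt (α * (p 0) ^ 2 + 2 * β * (p 0) + γ),
          p 1 * Real.sqrt (α * γ - β ^ 2) /
            Real.sqrt (α * (p 0) ^ 2 + 2 * β * (p 0) + γ)]])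
      (fun p => ![0, p 1])
      (fun _ => ![![0, 0], ![0, 0]])
      (fun _ => 0) := by
  refine ⟨⟨fun x hx i j => ?_, fun x _ i => ?_⟩, ⟨fun x hx i j => ?_, fun x _ i => ?_⟩⟩
  · change 0 < α * x 0 ^ 2 + 2 * β * x 0 + γ at hx
    have hs : 0 < Real.sqrt (α * x 0 ^ 2 + 2 * β * x 0 + γ) := Real.sqrt_pos.2 hx
    have hsq := Real.sq_sqrt hx.le
    have hr := Real.sq_sqrt hdisc
    fin_cases i <;> fin_cases j <;>
      simp [mixBracket, Fin.sum_univ_two, pd_sqrt_quadratic hx, pd_const, pd_snd,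
        pd_snd_mul_linear_div_sqrt_quadratic α β hx, pd_snd_mul_div_sqrt_quadratic _ hx] <;>
      generalize Real.sqrt (α * x 0 ^ 2 + 2 * β * x 0 + γ) = s at * <;>
      generalize Real.sqrt (α * γ - β ^ 2) = r at * <;>
      (try rw [← hsq]) <;>
      field_simp
    · ring
    · linear_combination x 1 ^ 2 * (α * hsq - hr)
  · fin_cases i <;>
      simp [vfApp, gen, Fin.sum_univ_two, pd_linear_fst, pd_mul_snd, pd_snd, pd_const, mul_comm]
  · change 0 < α * x 0 ^ 2 + 2 * β * x 0 + γ at hx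
    fin_cases i <;> fin_cases j <;>
      simp [mixBracket, Fin.sum_univ_two, pd_sqrt_quadratic hx, pd_const, pd_snd,
        pd_snd_mul_linear_div_sqrt_quadratic α β hx, pd_snd_mul_div_sqrt_quadratic _ hx] <;>
      ring
  · fin_cases i <;>
      simp [vfApp, gen, Fin.sum_univ_two, pd_mul_snd, pd_linear_fst, pd_snd, pd_const, mul_comm]
end
end

section
/- Let M̃ ⊆ ℝ^n be open and M = M̃ × ℝ^n with coordinates (x,v). Let F₀: M → ℝ^n be smooth and consider the smooth SDE (μ,σ) on M (with m noise components) given by μ(x,v) = (v¹,…,v^n, F₀¹(x,v),…,F₀^n(x,v))^T and σ(x,v) the (2n)×m matrix whose first n rows vanish and whose (n+i, α) entry is Ỹ_α^i(x), where Ỹ₁,…,Ỹ_m are smooth vector fields on M̃. Let Ỹ₀ be a smooth vector field on M̃, let Y be its prolongation to M, Y(x,v) = (Ỹ₀¹(x),…,Ỹ₀^n(x), Σ_k ∂_{x^k}(Ỹ₀¹)v^k,…, Σ_k ∂_{x^k}(Ỹ₀^n)v^k)^T, and suppose [Y, μ] = 0 on M (i.e., Y is a symmetry of the deterministic system ẍ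 = F₀(x,ẋ)). If there exists a smooth C: M̃ → so(m) such that [Ỹ₀, Ỹ_α] = −Σ_{β=1}^m C^β_α·Ỹ_β on M̃ for every α = 1,…,m, then V = (Y, C∘pr_x, 0), where pr_x(x,v) = x, is an infinitesimal symmetry of (μ,σ). -/
noncomputable section

open scoped BigOperators

/-- Position part of a point of the phase space `M̃ × ℝ^n ⊆ ℝ^{n+n}`. -/
def xpart {n : ℕ} (p : Fin (n + n) → ℝ) : Fin n → ℝ := fun i => p (Fin.castAdd n i)

/-- The projection `xpart` as a continuous linear map. -/
def xpartL (n : ℕ) : (Fin (n + n) → ℝ) →L[ℝ] (Fin n → ℝ) :=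
  ContinuousLinearMap.pi fun i => ContinuousLinearMap.proj (Fin.castAdd n i)

theorem xpartL_apply {n : ℕ} (p : Fin (n + n) → ℝ) : xpartL n p = xpart p := rfl

theorem continuous_xpart {n : ℕ} : Continuous (xpart : (Fin (n + n) → ℝ) → Fin n → ℝ) :=
  (xpartL n).continuous

theorem xpart_single_castAdd {n : ℕ} (k : Fin n) :
    xpart (Pi.single (Fin.castAdd n k) (1 : ℝ)) = Pi.single k 1 := by
  ext i
  simp [xpart, Pi.single_apply]

theorem xpart_single_natAdd {n : ℕ} (k : Fin n) :
    xpart (Pi.single (Fin.natAdd n k) (1 : ℝ)) = 0 := by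
  ext i
  have h : Fin.castAdd n i ≠ Fin.natAdd n k := by
    simp only [ne_eq, Fin.ext_iff, Fin.val_castAdd, Fin.val_natAdd]
    omega
  simp [xpart, h, -Fin.natAdd_eq_addNat]

theorem hasFDerivAt_comp_xpart {n : ℕ} {g : (Fin n → ℝ) → ℝ} {p : Fin (n + n) → ℝ}
    (hg : DifferentiableAt ℝ g (xpart p)) :
    HasFDerivAt (fun q => g (xpart q)) ((fderiv ℝ g (xpart p)).comp (xpartL n)) p :=
  HasFDerivAt.comp (f := xpartL n) p hg.hasFDerivAt (xpartL n).hasFDerivAt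

theorem pd_comp_xpart_castAdd {n : ℕ} {g : (Fin n → ℝ) → ℝ} {p : Fin (n + n) → ℝ}
    (hg : DifferentiableAt ℝ g (xpart p)) (k : Fin n) :
    pd (fun q => g (xpart q)) (Fin.castAdd n k) p = pd g k (xpart p) := by
  simp [pd, (hasFDerivAt_comp_xpart hg).fderiv, xpartL_apply, xpart_single_castAdd]

theorem pd_comp_xpart_natAdd {n : ℕ} {g : (Fin n → ℝ) → ℝ} {p : Fin (n + n) → ℝ}
    (hg : DifferentiableAt ℝ g (xpart p)) (k : Fin n) :
    pd (fun q => g (xpart q)) (Fin.natAdd n k) p = 0 := by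
  simp [pd, (hasFDerivAt_comp_xpart hg).fderiv, xpartL_apply, xpart_single_natAdd,
    -Fin.natAdd_eq_addNat]

/-- The velocity derivatives of a function that is linear in the velocities. -/
theorem pd_sum_mul_natAdd {n : ℕ} {g : Fin n → (Fin n → ℝ) → ℝ} {p : Fin (n + n) → ℝ}
    (hg : ∀ k, DifferentiableAt ℝ (g k) (xpart p)) (j : Fin n) :
    pd (fun q => ∑ k, g k (xpart q) * q (Fin.natAdd n k)) (Fin.natAdd n j) p
      = g j (xpart p) := by
  have h := HasFDerivAt.fun_sum (u := Finset.univ) fun k _ =>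
    (hasFDerivAt_comp_xpart (hg k)).mul (hasFDerivAt_apply (𝕜 := ℝ) (Fin.natAdd n k) p)
  rw [pd, HasFDerivAt.fderiv (f := fun q => ∑ k, g k (xpart q) * q (Fin.natAdd n k)) h]
  simp [xpartL_apply, xpart_single_natAdd, Pi.single_apply, -Fin.natAdd_eq_addNat]

theorem vfBracket_apply_eq {d : ℕ} (X Y : (Fin d → ℝ) → Fin d → ℝ) (x : Fin d → ℝ)
    (i : Fin d) :
    vfBracket X Y x i = vfApp X (fun y => Y y i) x - vfApp Y (fun y => X y i) x := by
  simp [vfBracket, vfApp, Finset.sum_sub_distrib]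

/-- Subsection 5.3.  Consider the stochastic perturbation
`dX = V dt`, `dV = F₀(X,V) dt + Σ_α Ỹ_α(X) dW^α` of the deterministic mechanical system
`ẍ = F₀(x,ẋ)`.  If the prolongation `Y` of a vector field `Ỹ₀` on `M̃` is a symmetry of
the deterministic system (`[Y,μ] = 0`) and `[Ỹ₀,Ỹ_α] = −Σ_β C^β_α Ỹ_β` for a smooth
`so(m)`-valued map `C` on `M̃`, then `V = (Y, C ∘ pr_x, 0)` is an infinitesimal symmetry of
the SDE. -/
theorem mechanical_perturbation_symmetry
    {n m : ℕ}
    (Mt : Set (Fin n → ℝ)) (hMtopen : IsOpen Mt)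
    (F₀ : (Fin (n + n) → ℝ) → Fin n → ℝ)
    (hF₀smooth : ContDiffOn ℝ (⊤ : ℕ∞) F₀ {p : Fin (n + n) → ℝ | xpart p ∈ Mt})
    (Yt : Fin m → (Fin n → ℝ) → Fin n → ℝ)
    (hYtsmooth : ∀ a, ContDiffOn ℝ (⊤ : ℕ∞) (Yt a) Mt)
    (Y0 : (Fin n → ℝ) → Fin n → ℝ)
    (hY0smooth : ContDiffOn ℝ (⊤ : ℕ∞) Y0 Mt)
    -- the prolongation `Y` of `Ỹ₀` is a symmetry of the deterministic system, `[Y,μ] = 0`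
    (hdet : ∀ p ∈ {p : Fin (n + n) → ℝ | xpart p ∈ Mt},
      vfBracket
        (fun q => Fin.addCases (fun i => Y0 (xpart q) i)
          (fun i => ∑ k : Fin n, pd (fun y => Y0 y i) k (xpart q) * q (Fin.natAdd n k)))
        (fun q => Fin.addCases (fun i => q (Fin.natAdd n i)) (fun i => F₀ q i)) p
      = 0)
    -- the `so(m)`-valued map `C` with `[Ỹ₀, Ỹ_α] = −Σ_β C^β_α·Ỹ_β`
    (C : (Fin n → ℝ) → Fin m → Fin m → ℝ)
    (hCsmooth : ContDiffOn ℝ (⊤ : ℕ∞) C Mt)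
    (hCso : ∀ x ∈ Mt, ∀ a b, C x a b = - C x b a)
    (hbr : ∀ a : Fin m, ∀ x ∈ Mt,
      vfBracket Y0 (Yt a) x = - ∑ b, C x b a • Yt b x) :
    IsSymmetry {p : Fin (n + n) → ℝ | xpart p ∈ Mt}
      (fun q => Fin.addCases (fun i => q (Fin.natAdd n i)) (fun i => F₀ q i))
      (fun q => Fin.addCases (motive := fun _ => Fin m → ℝ)
        (fun _ _ => 0) (fun i a => Yt a (xpart q) i))
      (fun q => Fin.addCases (fun i => Y0 (xpart q) i)
        (fun i => ∑ k : Fin n, pd (fun y => Y0 y i) k (xpart q) * q (Fin.natAdd n k)))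
      (fun q => C (xpart q))
      (fun _ => 0) := by
  have hY0diff {x : Fin n → ℝ} (hx : x ∈ Mt) (i : Fin n) :
      ContDiffAt ℝ (⊤ : ℕ∞) (fun y => Y0 y i) x :=
    contDiffAt_pi.1 (hY0smooth.contDiffAt (hMtopen.mem_nhds hx)) i
  have hY0 {x : Fin n → ℝ} (hx : x ∈ Mt) (i : Fin n) :
      DifferentiableAt ℝ (fun y => Y0 y i) x := (hY0diff hx i).differentiableAt (by simp)
  have hpdY0 {x : Fin n → ℝ} (hx : x ∈ Mt) (i k : Fin n) :
      DifferentiableAt ℝ (pd (fun y => Y0 y i) k) x :=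
    ((((hY0diff hx i).fderiv_right (m := (⊤ : ℕ∞))
      le_rfl).differentiableAt (by simp)).clm_apply
      (differentiableAt_const _))
  have hYt {x : Fin n → ℝ} (hx : x ∈ Mt) (a : Fin m) (i : Fin n) :
      DifferentiableAt ℝ (fun y => Yt a y i) x :=
    (contDiffAt_pi.1 ((hYtsmooth a).contDiffAt (hMtopen.mem_nhds hx)) i).differentiableAt
      (by simp)
  refine ⟨fun p hp i a => ?_, fun p hp i => ?_⟩
  · have hp' : xpart p ∈ Mt := hp
    induction i using Fin.addCases with
    | left i =>
      have h0 (k : Fin (n + n)) : pd (fun _ => (0 : ℝ)) k p = 0 := by simp [pd]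
      simp [mixBracket, Fin.sum_univ_add, pd_comp_xpart_natAdd (hY0 hp' i), h0,
        -Fin.natAdd_eq_addNat]
    | right i =>
      have h := congrFun (hbr a (xpart p) hp') i
      simp only [vfBracket, Pi.neg_apply, Finset.sum_apply, Pi.smul_apply, smul_eq_mul,
        Finset.sum_sub_distrib] at h
      simp only [mixBracket, Finset.sum_sub_distrib, Fin.sum_univ_add, Fin.addCases_left,
        Fin.addCases_right, pd_comp_xpart_castAdd (hYt hp' a i),
        pd_comp_xpart_natAdd (hYt hp' a i), pd_sum_mul_natAdd (hpdY0 hp' i)]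
      simp only [mul_zero, zero_mul, Finset.sum_const_zero, add_zero, zero_add, h, zero_sub]
      simp only [mul_comm]
  · have hp' : xpart p ∈ Mt := hp
    have hM : ∀ᶠ q in nhds p, xpart q ∈ Mt :=
      continuous_xpart.continuousAt.eventually (hMtopen.mem_nhds hp')
    have h := congrFun (hdet p hp) i
    rw [vfBracket_apply_eq] at h
    simp only [gen, neg_zero, zero_mul]
    rw [← sub_sub, sub_right_comm]
    refine (congrArg (· - _) h).trans ?_
    have hpd (j k : Fin n) : pd (fun y => pd (fun q =>
        (Fin.addCases (fun i => Y0 (xpart q) i) (fun i => ∑ k : Fin n,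
          pd (fun y => Y0 y i) k (xpart q) * q (Fin.natAdd n k)) : Fin (n + n) → ℝ) i)
          (Fin.natAdd n j) y) (Fin.natAdd n k) p = 0 := by
      induction i using Fin.addCases with
      | left i =>
        simp only [Fin.addCases_left]
        have he : (fun y => pd (fun q => Y0 (xpart q) i) (Fin.natAdd n j) y)
            =ᶠ[nhds p] fun _ => 0 := by
          filter_upwards [hM] with q hq using pd_comp_xpart_natAdd (hY0 hq i) j
        rw [pd, he.fderiv_eq]
        simp
      | right i =>
        simp only [Fin.addCases_right]
        have he : (fun y => pd (fun q => ∑ k : Fin n,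
            pd (fun y => Y0 y i) k (xpart q) * q (Fin.natAdd n k)) (Fin.natAdd n j) y)
            =ᶠ[nhds p] fun y => pd (fun y => Y0 y i) j (xpart y) := by
          filter_upwards [hM] with q hq using pd_sum_mul_natAdd (hpdY0 hq i) j
        rw [pd, he.fderiv_eq]
        exact pd_comp_xpart_natAdd (hpdY0 hp' i j) k
    simp only [Fin.sum_univ_add, Fin.addCases_left, zero_mul, mul_zero, hpd,
      Finset.sum_const_zero, add_zero, Pi.zero_apply, sub_zero]
end
end

section
/- Let α, ρ, β ∈ ℝ with 0 < β < 1 and 0 ≤ ρ ≤ 1, and let M = {(s,u) ∈ ℝ² : s > 0, u > 0}. Consider the SABR SDE (μ,σ) on M (with m = 2) given by μ = 0 and σ(s,u) = [[u·s^β, 0], [αuρ, αu√(1−ρ²)]]. Then V₁ = (Y₁, 0, τ₁) with Y₁(s,u) = (0,1)^T and τ₁(s,u) = −2/u, and V₂ = (Y₂, 0, 0) with Y₂(s,u) = (s, (1−β)u)^T, are infinitesimal symmetries of (μ,σ). -/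
noncomputable section

open scoped BigOperators

/-- A derivative given as a continuous linear map computes the partial derivatives. -/
lemma HasFDerivAt.pd_eq {d : ℕ} {f : (Fin d → ℝ) → ℝ} {f' : (Fin d → ℝ) →L[ℝ] ℝ}
    {x : Fin d → ℝ} (h : HasFDerivAt f f' x) (j : Fin d) : pd f j x = f' (Pi.single j 1) := by
  rw [pd, h.fderiv]

lemma pd_coord {d : ℕ} (i j : Fin d) (x : Fin d → ℝ) :
    pd (fun y => y i) j x = (Pi.single j 1 : Fin d → ℝ) i :=
  (hasFDerivAt_apply i x).pd_eq j

lemma pd_const_mul {d : ℕ} (c : ℝ) (f : (Fin d → ℝ) → ℝ) (j : Fin d) (x : Fin d → ℝ) :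
    pd (fun y => c * f y) j x = c * pd f j x := by
  have h := congrFun (fderiv_const_smul_field (𝕜 := ℝ) (f := f) c) x
  rw [pd, pd, show (fun y => c * f y) = c • f from rfl, h]
  rfl

lemma pd_mul_const {d : ℕ} (c : ℝ) (f : (Fin d → ℝ) → ℝ) (j : Fin d) (x : Fin d → ℝ) :
    pd (fun y => f y * c) j x = pd f j x * c := by
  simp only [mul_comm _ c, pd_const_mul]

lemma pd_coord_mul_rpow_coord {d : ℕ} (i k j : Fin d) (b : ℝ) {x : Fin d → ℝ} (hx : 0 < x k) :
    pd (fun y => y i * y k ^ b) j x =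
      x i * (b * x k ^ (b - 1) * (Pi.single j 1 : Fin d → ℝ) k)
        + x k ^ b * (Pi.single j 1 : Fin d → ℝ) i := by
  have h : HasFDerivAt (fun y : Fin d → ℝ => y i * y k ^ b) _ x :=
    (hasFDerivAt_apply i x).mul ((hasFDerivAt_apply k x).rpow_const (Or.inl hx.ne'))
  rw [h.pd_eq j]
  simp

/-- Subsection 5.4.  For the SABR model
`dS = U S^β dW¹`, `dU = αρU dW¹ + α√(1−ρ²)U dW²` on `{s > 0, u > 0}`, the triples
`V₁ = (Y₁,0,τ₁)` with `Y₁ = (0,1)ᵀ`, `τ₁ = −2/u`, and `V₂ = (Y₂,0,0)` with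
`Y₂ = (s,(1−β)u)ᵀ` are infinitesimal symmetries. -/
theorem SABR_symmetries
    (a ρ β : ℝ) (hβ : 0 < β ∧ β < 1) (hρ : 0 ≤ ρ ∧ ρ ≤ 1) :
    IsSymmetry (m := 2) {p : Fin 2 → ℝ | 0 < p 0 ∧ 0 < p 1}
      (fun _ => ![0, 0])
      (fun p => ![![p 1 * Real.rpow (p 0) β, 0],
        ![a * p 1 * ρ, a * p 1 * Real.sqrt (1 - ρ ^ 2)]])
      (fun _ => ![0, 1])
      (fun _ => ![![0, 0], ![0, 0]])
      (fun p => -2 / p 1)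
    ∧
    IsSymmetry (m := 2) {p : Fin 2 → ℝ | 0 < p 0 ∧ 0 < p 1}
      (fun _ => ![0, 0])
      (fun p => ![![p 1 * Real.rpow (p 0) β, 0],
        ![a * p 1 * ρ, a * p 1 * Real.sqrt (1 - ρ ^ 2)]])
      (fun p => ![p 0, (1 - β) * p 1])
      (fun _ => ![![0, 0], ![0, 0]])
      (fun _ => 0) := by
  refine ⟨⟨?_, ?_⟩, ⟨?_, ?_⟩⟩
  · rintro x ⟨hs, hu⟩ i j
    fin_cases i <;> fin_cases j <;>
      simp [mixBracket, Fin.sum_univ_two, pd_const, pd_coord, pd_const_mul, pd_mul_const,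
        pd_coord_mul_rpow_coord 1 0 _ β hs] <;> field_simp
  · rintro x - i
    fin_cases i <;> simp [vfApp, gen, pd_const]
  · rintro x ⟨hs, hu⟩ i j
    have hpow : x 0 ^ (β - 1) * x 0 = x 0 ^ β := by
      rw [Real.rpow_sub_one hs.ne', div_mul_cancel₀ _ hs.ne']
    fin_cases i <;> fin_cases j <;>
      simp [mixBracket, Fin.sum_univ_two, pd_const, pd_coord, pd_const_mul, pd_mul_const,
        pd_coord_mul_rpow_coord 1 0 _ β hs]
    · linear_combination β * x 1 * hpow
    · ring
    · ring
  · rintro x - i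
    fin_cases i <;> simp [vfApp, gen, pd_const, pd_coord, pd_const_mul]
end
end

section
/- Let M ⊆ ℝ^n be an open set and m a positive integer. The set V_m(M) of infinitesimal stochastic transformations V = (Y,C,τ) on M, equipped with the bracket [V₁,V₂] = ([Y₁,Y₂], Y₁(C₂) − Y₂(C₁) − (C₁·C₂ − C₂·C₁), Y₁(τ₂) − Y₂(τ₁)), is a Lie algebra over ℝ: the bracket of two infinitesimal stochastic transformations is again an infinitesimal stochastic transformation (in particular its second component is so(m)-valued), and the bracket is ℝ-bilinear, antisymmetric, and satisfies the Jacobi identity [V₁,[V₂,V₃]] + [V₂,[V₃,V₁]] + [V₃,[V₁,V₂]] = 0. -/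
noncomputable section

open scoped BigOperators

/-- The data of an infinitesimal stochastic transformation `V = (Y,C,τ)`. -/
abbrev ISTData (n m : ℕ) :=
  ((Fin n → ℝ) → Fin n → ℝ) × ((Fin n → ℝ) → Fin m → Fin m → ℝ) × ((Fin n → ℝ) → ℝ)

/-- `V = (Y,C,τ)` is an infinitesimal stochastic transformation on `M`:
all components are smooth and `C` is `so(m)`-valued. -/
def IsIST {n m : ℕ} (M : Set (Fin n → ℝ)) (V : ISTData n m) : Prop :=
  ContDiffOn ℝ (⊤ : ℕ∞) V.1 M ∧ ContDiffOn ℝ (⊤ : ℕ∞) V.2.1 M ∧ ContDiffOn ℝ (⊤ : ℕ∞) V.2.2 M ∧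
    ∀ x ∈ M, ∀ a b, V.2.1 x a b = - V.2.1 x b a

/-- The bracket
`[V₁,V₂] = ([Y₁,Y₂], Y₁(C₂) − Y₂(C₁) − (C₁C₂ − C₂C₁), Y₁(τ₂) − Y₂(τ₁))`. -/
def istBracket {n m : ℕ} (V W : ISTData n m) : ISTData n m :=
  (fun x => vfBracket V.1 W.1 x,
   fun x a b => vfApp V.1 (fun y => W.2.1 y a b) x - vfApp W.1 (fun y => V.2.1 y a b) x
     - (∑ e, (V.2.1 x a e * W.2.1 x e b - W.2.1 x a e * V.2.1 x e b)),
   fun x => vfApp V.1 W.2.2 x - vfApp W.1 V.2.2 x)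

/-- Two infinitesimal stochastic transformations agree at a point. -/
def istEqAt {n m : ℕ} (V W : ISTData n m) (x : Fin n → ℝ) : Prop :=
  V.1 x = W.1 x ∧ V.2.1 x = W.2.1 x ∧ V.2.2 x = W.2.2 x

section Lemmas

variable {n m : ℕ} {M : Set (Fin n → ℝ)}

section VectorFields

variable {X Y Z : (Fin n → ℝ) → Fin n → ℝ} {f g : (Fin n → ℝ) → ℝ} {x : Fin n → ℝ}

lemma vfApp_eq_fderiv (Y : (Fin n → ℝ) → Fin n → ℝ) (f : (Fin n → ℝ) → ℝ) (x : Fin n → ℝ) :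
    vfApp Y f x = fderiv ℝ f x (Y x) := by
  conv_rhs => rw [← Finset.univ_sum_single (Y x), map_sum]
  refine Finset.sum_congr rfl fun k _ => ?_
  rw [pd, ← smul_eq_mul, ← map_smul, ← Pi.single_smul, smul_eq_mul, mul_one]

lemma vfApp_add (hf : DifferentiableAt ℝ f x) (hg : DifferentiableAt ℝ g x) :
    vfApp Y (fun y => f y + g y) x = vfApp Y f x + vfApp Y g x := by
  simp only [vfApp_eq_fderiv, fderiv_fun_add hf hg, _root_.add_apply]

lemma vfApp_sub (hf : DifferentiableAt ℝ f x) (hg : DifferentiableAt ℝ g x) :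
    vfApp Y (fun y => f y - g y) x = vfApp Y f x - vfApp Y g x := by
  simp only [vfApp_eq_fderiv, fderiv_fun_sub hf hg, _root_.sub_apply]

lemma vfApp_const_mul (hf : DifferentiableAt ℝ f x) (c : ℝ) :
    vfApp Y (fun y => c * f y) x = c * vfApp Y f x := by
  simp [vfApp_eq_fderiv, fderiv_const_mul hf]

lemma vfApp_mul (hf : DifferentiableAt ℝ f x) (hg : DifferentiableAt ℝ g x) :
    vfApp Y (fun y => f y * g y) x = vfApp Y f x * g x + f x * vfApp Y g x := by
  simp only [vfApp_eq_fderiv, fderiv_fun_mul hf hg, _root_.add_apply,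
    _root_.smul_apply, smul_eq_mul]
  ring

lemma vfApp_sum {ι : Type*} {s : Finset ι} {F : ι → (Fin n → ℝ) → ℝ}
    (hF : ∀ e ∈ s, DifferentiableAt ℝ (F e) x) :
    vfApp Y (fun y => ∑ e ∈ s, F e y) x = ∑ e ∈ s, vfApp Y (F e) x := by
  simp only [vfApp_eq_fderiv, fderiv_fun_sum hF, _root_.sum_apply]

lemma vfApp_combination (a b : ℝ) (Y Z : (Fin n → ℝ) → Fin n → ℝ) (f : (Fin n → ℝ) → ℝ)
    (x : Fin n → ℝ) : vfApp (a • Y + b • Z) f x = a * vfApp Y f x + b * vfApp Z f x := by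
  simp [vfApp_eq_fderiv]

lemma vfApp_fun_combination (hf : DifferentiableAt ℝ f x) (hg : DifferentiableAt ℝ g x)
    (a b : ℝ) :
    vfApp Y (fun y => a * f y + b * g y) x = a * vfApp Y f x + b * vfApp Y g x := by
  rw [vfApp_add (hf.const_mul a) (hg.const_mul b), vfApp_const_mul hf, vfApp_const_mul hg]

lemma vfBracket_apply (X Y : (Fin n → ℝ) → Fin n → ℝ) (x : Fin n → ℝ) (i : Fin n) :
    vfBracket X Y x i = vfApp X (fun y => Y y i) x - vfApp Y (fun y => X y i) x := by
  simp only [vfBracket, vfApp, Finset.sum_sub_distrib]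

lemma vfBracket_eq_fderiv (hX : DifferentiableAt ℝ X x) (hY : DifferentiableAt ℝ Y x) :
    vfBracket X Y x = fderiv ℝ Y x (X x) - fderiv ℝ X x (Y x) := by
  ext i
  rw [vfBracket_apply, vfApp_eq_fderiv, vfApp_eq_fderiv, fderiv_apply hX, fderiv_apply hY]
  rfl

lemma ContDiffOn.vfApp (hM : IsOpen M) (hY : ContDiffOn ℝ (⊤ : ℕ∞) Y M)
    (hf : ContDiffOn ℝ (⊤ : ℕ∞) f M) : ContDiffOn ℝ (⊤ : ℕ∞) (vfApp Y f) M := by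
  rw [show _root_.vfApp Y f = fun x => fderiv ℝ f x (Y x) from
    funext fun x => vfApp_eq_fderiv Y f x]
  exact (hf.fderiv_of_isOpen hM (by simp)).clm_apply hY

lemma ContDiffOn.differentiableAt_of_isOpen {E : Type*} [NormedAddCommGroup E] [NormedSpace ℝ E]
    {F : (Fin n → ℝ) → E} (hM : IsOpen M) (hF : ContDiffOn ℝ (⊤ : ℕ∞) F M) (hx : x ∈ M) :
    DifferentiableAt ℝ F x :=
  (hF.contDiffAt (hM.mem_nhds hx)).differentiableAt (by simp)

lemma vfApp_vfApp (hM : IsOpen M) (hY : ContDiffOn ℝ (⊤ : ℕ∞) Y M)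
    (hf : ContDiffOn ℝ (⊤ : ℕ∞) f M) (hx : x ∈ M) :
    vfApp X (vfApp Y f) x =
      fderiv ℝ (fderiv ℝ f) x (X x) (Y x) + fderiv ℝ f x (fderiv ℝ Y x (X x)) := by
  have h : vfApp Y f = fun x => fderiv ℝ f x (Y x) := funext fun x => vfApp_eq_fderiv Y f x
  have hdf : ContDiffOn ℝ (⊤ : ℕ∞) (fderiv ℝ f) M := hf.fderiv_of_isOpen hM (by simp)
  rw [vfApp_eq_fderiv, h, fderiv_clm_apply (hdf.differentiableAt_of_isOpen hM hx)
    (hY.differentiableAt_of_isOpen hM hx)]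
  simp [add_comm]

/-- The Lie bracket acts on functions as the commutator of derivations. -/
lemma vfApp_vfBracket (hM : IsOpen M) (hX : ContDiffOn ℝ (⊤ : ℕ∞) X M)
    (hY : ContDiffOn ℝ (⊤ : ℕ∞) Y M) (hf : ContDiffOn ℝ (⊤ : ℕ∞) f M) (hx : x ∈ M) :
    vfApp (vfBracket X Y) f x = vfApp X (vfApp Y f) x - vfApp Y (vfApp X f) x := by
  have hsymm : IsSymmSndFDerivAt ℝ f x :=
    (hf.contDiffAt (hM.mem_nhds hx)).isSymmSndFDerivAt <| by
      rw [minSmoothness_of_isRCLikeNormedField]; exact WithTop.coe_le_coe.2 (le_top (a := (2 : ℕ∞)))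
  rw [vfApp_vfApp hM hY hf hx, vfApp_vfApp hM hX hf hx, vfApp_eq_fderiv,
    vfBracket_eq_fderiv (hX.differentiableAt_of_isOpen hM hx)
      (hY.differentiableAt_of_isOpen hM hx), map_sub, hsymm.eq (X x) (Y x)]
  ring

lemma ContDiffOn.vfBracket (hM : IsOpen M) (hX : ContDiffOn ℝ (⊤ : ℕ∞) X M)
    (hY : ContDiffOn ℝ (⊤ : ℕ∞) Y M) : ContDiffOn ℝ (⊤ : ℕ∞) (vfBracket X Y) M := by
  refine contDiffOn_pi.2 fun i => ?_
  simp only [vfBracket_apply]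
  exact (hX.vfApp hM (contDiffOn_pi.1 hY i)).sub (hY.vfApp hM (contDiffOn_pi.1 hX i))

/-- The Jacobi identity for `Y₁(f₂₃) - [Y₂,Y₃](f₁)` with `f₂₃ = Y₂(f₃) - Y₃(f₂)`. -/
lemma vfApp_jacobi (hM : IsOpen M) (hX : ContDiffOn ℝ (⊤ : ℕ∞) X M)
    (hY : ContDiffOn ℝ (⊤ : ℕ∞) Y M) (hZ : ContDiffOn ℝ (⊤ : ℕ∞) Z M)
    {h : (Fin n → ℝ) → ℝ} (hf : ContDiffOn ℝ (⊤ : ℕ∞) f M) (hg : ContDiffOn ℝ (⊤ : ℕ∞) g M)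
    (hh : ContDiffOn ℝ (⊤ : ℕ∞) h M) (hx : x ∈ M) :
    (vfApp X (fun y => vfApp Y h y - vfApp Z g y) x - vfApp (vfBracket Y Z) f x)
      + (vfApp Y (fun y => vfApp Z f y - vfApp X h y) x - vfApp (vfBracket Z X) g x)
      + (vfApp Z (fun y => vfApp X g y - vfApp Y f y) x - vfApp (vfBracket X Y) h x) = 0 := by
  have d : ∀ {W : (Fin n → ℝ) → Fin n → ℝ} {k : (Fin n → ℝ) → ℝ}, ContDiffOn ℝ (⊤ : ℕ∞) W M →
      ContDiffOn ℝ (⊤ : ℕ∞) k M → DifferentiableAt ℝ (vfApp W k) x :=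
    fun hW hk => (hW.vfApp hM hk).differentiableAt_of_isOpen hM hx
  rw [vfApp_sub (d hY hh) (d hZ hg), vfApp_sub (d hZ hf) (d hX hh), vfApp_sub (d hX hg) (d hY hf),
    vfApp_vfBracket hM hY hZ hf hx, vfApp_vfBracket hM hZ hX hg hx,
    vfApp_vfBracket hM hX hY hh hx]
  ring

end VectorFields

/-- Entrywise derivative of a matrix-valued function along a vector field. -/
def vfAppMatrix (Y : (Fin n → ℝ) → Fin n → ℝ) (C : (Fin n → ℝ) → Fin m → Fin m → ℝ)
    (x : Fin n → ℝ) : Matrix (Fin m) (Fin m) ℝ :=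
  Matrix.of fun a b => vfApp Y (fun y => C y a b) x

lemma istBracket_matrix (V W : ISTData n m) (x : Fin n → ℝ) :
    Matrix.of ((istBracket V W).2.1 x) = vfAppMatrix V.1 W.2.1 x - vfAppMatrix W.1 V.2.1 x
      - (Matrix.of (V.2.1 x) * Matrix.of (W.2.1 x)
        - Matrix.of (W.2.1 x) * Matrix.of (V.2.1 x)) := by
  ext a b
  simp [istBracket, vfAppMatrix, Matrix.mul_apply, Finset.sum_sub_distrib]

namespace IsIST

variable {V W U : ISTData n m} {x : Fin n → ℝ}

lemma contDiffOn_field (hV : IsIST M V) (i : Fin n) :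
    ContDiffOn ℝ (⊤ : ℕ∞) (fun y => V.1 y i) M :=
  contDiffOn_pi.1 hV.1 i

lemma contDiffOn_entry (hV : IsIST M V) (a b : Fin m) :
    ContDiffOn ℝ (⊤ : ℕ∞) (fun y => V.2.1 y a b) M :=
  contDiffOn_pi.1 (contDiffOn_pi.1 hV.2.1 a) b

lemma vfApp_entry_swap (hM : IsOpen M) (hV : IsIST M V) (hx : x ∈ M)
    (Y : (Fin n → ℝ) → Fin n → ℝ) (a b : Fin m) :
    vfApp Y (fun y => V.2.1 y a b) x = -vfApp Y (fun y => V.2.1 y b a) x := by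
  have h : (fun y => V.2.1 y a b) =ᶠ[nhds x] fun y => -V.2.1 y b a :=
    Filter.eventually_of_mem (hM.mem_nhds hx) fun y hy => hV.2.2.2 y hy a b
  simp [vfApp_eq_fderiv, h.fderiv_eq]

lemma istBracket (hM : IsOpen M) (hV : IsIST M V) (hW : IsIST M W) :
    IsIST M (istBracket V W) := by
  refine ⟨hV.1.vfBracket hM hW.1, ?_,
    (hV.1.vfApp hM hW.2.2.1).sub (hW.1.vfApp hM hV.2.2.1), fun x hx a b => ?_⟩
  · refine contDiffOn_pi.2 fun a => contDiffOn_pi.2 fun b => ?_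
    exact ((hV.1.vfApp hM (hW.contDiffOn_entry a b)).sub
      (hW.1.vfApp hM (hV.contDiffOn_entry a b))).sub
      (ContDiffOn.sum fun e _ => ((hV.contDiffOn_entry a e).mul (hW.contDiffOn_entry e b)).sub
        ((hW.contDiffOn_entry a e).mul (hV.contDiffOn_entry e b)))
  · have hsum : ∑ e, (V.2.1 x a e * W.2.1 x e b - W.2.1 x a e * V.2.1 x e b)
        = -∑ e, (V.2.1 x b e * W.2.1 x e a - W.2.1 x b e * V.2.1 x e a) := by
      rw [← Finset.sum_neg_distrib]
      refine Finset.sum_congr rfl fun e _ => ?_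
      rw [hV.2.2.2 x hx a e, hV.2.2.2 x hx e b, hW.2.2.2 x hx a e, hW.2.2.2 x hx e b]
      ring
    simp only [_root_.istBracket]
    rw [hsum, hW.vfApp_entry_swap hM hx V.1 a b, hV.vfApp_entry_swap hM hx W.1 a b]
    ring

lemma vfAppMatrix_istBracket (hM : IsOpen M) (hV : IsIST M V) (hW : IsIST M W) (hx : x ∈ M)
    (X : (Fin n → ℝ) → Fin n → ℝ) :
    vfAppMatrix X (_root_.istBracket V W).2.1 x =
      Matrix.of (fun a b => vfApp X (fun y => vfApp V.1 (fun z => W.2.1 z a b) y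
        - vfApp W.1 (fun z => V.2.1 z a b) y) x)
      - (vfAppMatrix X V.2.1 x * Matrix.of (W.2.1 x) + Matrix.of (V.2.1 x) * vfAppMatrix X W.2.1 x
        - (vfAppMatrix X W.2.1 x * Matrix.of (V.2.1 x)
          + Matrix.of (W.2.1 x) * vfAppMatrix X V.2.1 x)) := by
  have dV a b := (hV.contDiffOn_entry a b).differentiableAt_of_isOpen hM hx
  have dW a b := (hW.contDiffOn_entry a b).differentiableAt_of_isOpen hM hx
  have dVW a b := (hV.1.vfApp hM (hW.contDiffOn_entry a b)).differentiableAt_of_isOpen hM hx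
  have dWV a b := (hW.1.vfApp hM (hV.contDiffOn_entry a b)).differentiableAt_of_isOpen hM hx
  ext a b
  have hs : ∀ e ∈ (Finset.univ : Finset (Fin m)), DifferentiableAt ℝ
      (fun y => V.2.1 y a e * W.2.1 y e b - W.2.1 y a e * V.2.1 y e b) x :=
    fun e _ => ((dV a e).mul (dW e b)).sub ((dW a e).mul (dV e b))
  simp only [vfAppMatrix, _root_.istBracket, Matrix.of_apply, Matrix.sub_apply, Matrix.add_apply,
    Matrix.mul_apply]
  rw [vfApp_sub ((dVW a b).fun_sub (dWV a b)) (DifferentiableAt.fun_sum hs), vfApp_sum hs,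
    ← Finset.sum_add_distrib, ← Finset.sum_add_distrib, ← Finset.sum_sub_distrib]
  refine congrArg _ (Finset.sum_congr rfl fun e _ => ?_)
  rw [vfApp_sub ((dV a e).fun_mul (dW e b)) ((dW a e).fun_mul (dV e b)), vfApp_mul (dV a e) (dW e b),
    vfApp_mul (dW a e) (dV e b)]

lemma istBracket_jacobi (hM : IsOpen M) (hV : IsIST M V) (hW : IsIST M W) (hU : IsIST M U)
    (hx : x ∈ M) :
    istEqAt (_root_.istBracket V (_root_.istBracket W U)
      + _root_.istBracket W (_root_.istBracket U V)
      + _root_.istBracket U (_root_.istBracket V W)) 0 x := by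
  refine ⟨?_, ?_, vfApp_jacobi hM hV.1 hW.1 hU.1 hV.2.2.1 hW.2.2.1 hU.2.2.1 hx⟩
  · ext i
    have h := vfApp_jacobi hM hV.1 hW.1 hU.1 (hV.contDiffOn_field i) (hW.contDiffOn_field i)
      (hU.contDiffOn_field i) hx
    simp only [← vfBracket_apply] at h
    exact h
  · have h : Matrix.of (fun a b => vfApp V.1 (fun y => vfApp W.1 (fun z => U.2.1 z a b) y
          - vfApp U.1 (fun z => W.2.1 z a b) y) x) - vfAppMatrix (vfBracket W.1 U.1) V.2.1 x
        + (Matrix.of (fun a b => vfApp W.1 (fun y => vfApp U.1 (fun z => V.2.1 z a b) y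
          - vfApp V.1 (fun z => U.2.1 z a b) y) x) - vfAppMatrix (vfBracket U.1 V.1) W.2.1 x)
        + (Matrix.of (fun a b => vfApp U.1 (fun y => vfApp V.1 (fun z => W.2.1 z a b) y
          - vfApp W.1 (fun z => V.2.1 z a b) y) x) - vfAppMatrix (vfBracket V.1 W.1) U.2.1 x)
        = 0 := by
      ext a b
      exact vfApp_jacobi hM hV.1 hW.1 hU.1 (hV.contDiffOn_entry a b) (hW.contDiffOn_entry a b)
        (hU.contDiffOn_entry a b) hx
    change Matrix.of ((_root_.istBracket V (_root_.istBracket W U)).2.1 x)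
      + Matrix.of ((_root_.istBracket W (_root_.istBracket U V)).2.1 x)
      + Matrix.of ((_root_.istBracket U (_root_.istBracket V W)).2.1 x) = 0
    simp only [istBracket_matrix V, istBracket_matrix W, istBracket_matrix U,
      vfAppMatrix_istBracket hM hV hW hx, vfAppMatrix_istBracket hM hW hU hx,
      vfAppMatrix_istBracket hM hU hV hx]
    rw [← h]
    simp only [_root_.istBracket]
    noncomm_ring

lemma istBracket_combination_left (hM : IsOpen M) (hV : IsIST M V) (hU : IsIST M U)
    (a b : ℝ) (W : ISTData n m) (hx : x ∈ M) :
    istEqAt (_root_.istBracket (a • V + b • U) W)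
      (a • _root_.istBracket V W + b • _root_.istBracket U W) x := by
  have key : ∀ {f g h : (Fin n → ℝ) → ℝ}, ContDiffOn ℝ (⊤ : ℕ∞) f M →
      ContDiffOn ℝ (⊤ : ℕ∞) g M →
      vfApp (a • V.1 + b • U.1) h x - vfApp W.1 (fun y => a * f y + b * g y) x
        = a * (vfApp V.1 h x - vfApp W.1 f x) + b * (vfApp U.1 h x - vfApp W.1 g x) := by
    intro f g h hf hg
    rw [vfApp_combination, vfApp_fun_combination (hf.differentiableAt_of_isOpen hM hx)
      (hg.differentiableAt_of_isOpen hM hx)]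
    ring
  refine ⟨?_, ?_, key hV.2.2.1 hU.2.2.1⟩
  · ext i
    change vfBracket (a • V.1 + b • U.1) W.1 x i
      = a * vfBracket V.1 W.1 x i + b * vfBracket U.1 W.1 x i
    simp only [vfBracket_apply]
    exact key (hV.contDiffOn_field i) (hU.contDiffOn_field i)
  · ext c d
    have hk := key (h := fun y => W.2.1 y c d) (hV.contDiffOn_entry c d) (hU.contDiffOn_entry c d)
    have hs : ∑ e, ((a * V.2.1 x c e + b * U.2.1 x c e) * W.2.1 x e d
          - W.2.1 x c e * (a * V.2.1 x e d + b * U.2.1 x e d))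
        = a * ∑ e, (V.2.1 x c e * W.2.1 x e d - W.2.1 x c e * V.2.1 x e d)
          + b * ∑ e, (U.2.1 x c e * W.2.1 x e d - W.2.1 x c e * U.2.1 x e d) := by
      rw [Finset.mul_sum, Finset.mul_sum, ← Finset.sum_add_distrib]
      exact Finset.sum_congr rfl fun e _ => by ring
    refine (congrArg₂ (· - ·) hk hs).trans ?_
    simp only [_root_.istBracket, Prod.fst_add, Prod.snd_add, Prod.smul_fst, Prod.smul_snd,
      Pi.add_apply, Pi.smul_apply, smul_eq_mul]
    ring

end IsIST

lemma istBracket_antisymm (V W : ISTData n m) : istBracket V W = -istBracket W V := by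
  refine Prod.ext ?_ (Prod.ext ?_ ?_)
  · ext x i
    simp [istBracket, vfBracket_apply]
  · ext x a b
    simp only [istBracket, Finset.sum_sub_distrib, Prod.snd_neg, Prod.fst_neg, Pi.neg_apply]
    ring
  · ext x
    simp [istBracket]

lemma IsIST.istBracket_combination_right {V U : ISTData n m} {x : Fin n → ℝ} (hM : IsOpen M)
    (hV : IsIST M V) (hU : IsIST M U) (a b : ℝ) (W : ISTData n m) (hx : x ∈ M) :
    istEqAt (_root_.istBracket W (a • V + b • U))
      (a • _root_.istBracket W V + b • _root_.istBracket W U) x := by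
  rw [istBracket_antisymm W, istBracket_antisymm W V, istBracket_antisymm W U, smul_neg, smul_neg,
    ← neg_add]
  obtain ⟨h₁, h₂, h₃⟩ := hV.istBracket_combination_left hM hU a b W hx
  exact ⟨congrArg Neg.neg h₁, congrArg Neg.neg h₂, congrArg Neg.neg h₃⟩

end Lemmas

/-- Section 3.  The set `V_m(M)` of infinitesimal stochastic
transformations, with the bracket `[·,·]`, is a Lie algebra over `ℝ`: it is closed under the
bracket (whose second component is again `so(m)`-valued), and on `M` the bracket is
`ℝ`-bilinear, antisymmetric and satisfies the Jacobi identity. -/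
theorem ist_lie_algebra
    {n m : ℕ} (M : Set (Fin n → ℝ)) (hMopen : IsOpen M) :
    -- closure
    (∀ V W : ISTData n m, IsIST M V → IsIST M W → IsIST M (istBracket V W)) ∧
    -- ℝ-bilinearity (in the first and in the second argument)
    (∀ (a b : ℝ) (V V' W : ISTData n m), IsIST M V → IsIST M V' → IsIST M W →
      ∀ x ∈ M,
        istEqAt (istBracket (a • V + b • V') W)
          (a • istBracket V W + b • istBracket V' W) x ∧
        istEqAt (istBracket W (a • V + b • V'))
          (a • istBracket W V + b • istBracket W V') x) ∧
    -- antisymmetry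
    (∀ V W : ISTData n m, IsIST M V → IsIST M W →
      ∀ x ∈ M, istEqAt (istBracket V W) (-(istBracket W V)) x) ∧
    -- Jacobi identity
    (∀ V₁ V₂ V₃ : ISTData n m, IsIST M V₁ → IsIST M V₂ → IsIST M V₃ →
      ∀ x ∈ M,
        istEqAt (istBracket V₁ (istBracket V₂ V₃) + istBracket V₂ (istBracket V₃ V₁)
          + istBracket V₃ (istBracket V₁ V₂)) 0 x) := by
  exact ⟨fun V W hV hW => hV.istBracket hMopen hW,
    fun a b V V' W hV hV' _ x hx => ⟨hV.istBracket_combination_left hMopen hV' a b W hx,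
      hV.istBracket_combination_right hMopen hV' a b W hx⟩,
    fun V W _ _ x _ => by rw [istBracket_antisymm V W]; exact ⟨rfl, rfl, rfl⟩,
    fun V₁ V₂ V₃ h₁ h₂ h₃ x hx => h₁.istBracket_jacobi hMopen h₂ h₃ hx⟩
end
end
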